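/- Let n ≥ 2 and b₁, σ₂ ∈ ℝ, and define c₁ := b₁ and c_j := j·b₁ + ½ j(j−1)·σ₂ for j ≥ 2. Then the condition '(c_j ≠ 0 for every 2 ≤ j ≤ n) and (c_j ≠ c_i for every 1 ≤ j < i ≤ n)' holds if and only if b₁ ≠ −(k/2)·σ₂ for every integer 1 ≤ k ≤ 2(n−1). In particular, under this condition b₁ and σ₂ cannot both be zero. -/

import Mathlib

open Matrix MeasureTheory

namespace Correlators

lemma pos_left {a b k : ℕ} (h : k < a * b) : 0 < a := by
  rcases Nat.eq_zero_or_pos a with rfl | h'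
  · simp at h
  · exact h'

lemma pos_right {a b k : ℕ} (h : k < a * b) : 0 < b := by
  rcases Nat.eq_zero_or_pos b with rfl | h'
  · simp at h
  · exact h'

lemma div_lt_left {a c k : ℕ} (h : k < a * c) : k / c < a :=
  Nat.div_lt_of_lt_mul (by rwa [Nat.mul_comm] at h)

lemma unvec_idx {p q : ℕ} (i : Fin p) (j : Fin q) : j.1 * p + i.1 < p * q :=
  calc j.1 * p + i.1 < j.1 * p + p := Nat.add_lt_add_left i.2 _
    _ = (j.1 + 1) * p := by ring
    _ ≤ q * p := Nat.mul_le_mul_right p j.2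
    _ = p * q := Nat.mul_comm q p

/-- `H_N(x) = (1, x, x², …, x^N)ᵀ ∈ ℝ^{N+1}`, the monomial basis vector. -/
def Hmon (N : ℕ) (x : ℝ) : Fin (N + 1) → ℝ := fun i => x ^ (i : ℕ)

/-- Vectorization of a matrix: stacks the columns, `vec(A)_{n(j-1)+i} = A_{i,j}` (1-based). -/
def vec {n m : ℕ} (A : Matrix (Fin n) (Fin m) ℝ) : Fin (n * m) → ℝ :=
  fun k => A ⟨k.1 % n, Nat.mod_lt _ (pos_left k.2)⟩ ⟨k.1 / n, Nat.div_lt_of_lt_mul k.2⟩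

/-- Inverse vectorization: `unvec w` is the `p × q` matrix `B` with `B_{i,j} = w_{p(j-1)+i}`. -/
def unvec {p q : ℕ} (w : Fin (p * q) → ℝ) : Matrix (Fin p) (Fin q) ℝ :=
  Matrix.of fun i j => w ⟨j.1 * p + i.1, unvec_idx i j⟩

/-- L-vectorization: the first column of `A` followed by the last row of `A`. -/
def vecL {n m : ℕ} (A : Matrix (Fin n) (Fin m) ℝ) : Fin (n + m - 1) → ℝ :=
  fun k =>
    if h : k.1 < n then
      if hm : 0 < m then A ⟨k.1, h⟩ ⟨0, hm⟩ else 0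
    else
      if hn : 0 < n then
        A ⟨n - 1, Nat.sub_lt hn Nat.one_pos⟩ ⟨k.1 - n + 1, by have hk := k.2; omega⟩
      else 0

/-- A matrix is Hankel if its entries are constant along skew-diagonals. -/
def IsHankel {n m : ℕ} (A : Matrix (Fin n) (Fin m) ℝ) : Prop :=
  ∀ (i i' : Fin n) (j j' : Fin m), i.1 + j.1 = i'.1 + j'.1 → A i j = A i' j'

/-- Kronecker product of matrices, with flattened `Fin` indices:
`(A ⊗ B)_{(i-1)c+p,(j-1)d+q} = A_{i,j} B_{p,q}` (1-based). -/
def kron {a b c d : ℕ} (A : Matrix (Fin a) (Fin b) ℝ) (B : Matrix (Fin c) (Fin d) ℝ) :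
    Matrix (Fin (a * c)) (Fin (b * d)) ℝ :=
  Matrix.of fun i j =>
    A ⟨i.1 / c, div_lt_left i.2⟩ ⟨j.1 / d, div_lt_left j.2⟩ *
      B ⟨i.1 % c, Nat.mod_lt _ (pos_right i.2)⟩ ⟨j.1 % d, Nat.mod_lt _ (pos_right j.2)⟩

/-- Kronecker product of (column) vectors: `(u ⊗ v)_{(i-1)b+j} = u_i v_j` (1-based). -/
def vkron {a b : ℕ} (u : Fin a → ℝ) (v : Fin b → ℝ) : Fin (a * b) → ℝ :=
  fun k => u ⟨k.1 / b, div_lt_left k.2⟩ * v ⟨k.1 % b, Nat.mod_lt _ (pos_right k.2)⟩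

/-- Kronecker power of a vector: `u^{⊗0} = 1`, `u^{⊗(r+1)} = u^{⊗r} ⊗ u`. -/
def vkronPow {a : ℕ} (u : Fin a → ℝ) : (r : ℕ) → Fin (a ^ r) → ℝ
  | 0 => fun _ => 1
  | r + 1 => fun k => vkron (vkronPow u r) u (Fin.cast (pow_succ a r) k)

/-- A vector viewed as a one-row matrix (its transpose as a column vector). -/
def rowOf {N : ℕ} (u : Fin N → ℝ) : Matrix (Fin 1) (Fin N) ℝ := Matrix.of fun _ j => u j

/-- A vector viewed as a one-column matrix. -/
def colOf {N : ℕ} (u : Fin N → ℝ) : Matrix (Fin N) (Fin 1) ℝ := Matrix.of fun i _ => u i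

/-- Kronecker power of a matrix. -/
def mkronPow {a b : ℕ} (A : Matrix (Fin a) (Fin b) ℝ) :
    (r : ℕ) → Matrix (Fin (a ^ r)) (Fin (b ^ r)) ℝ
  | 0 => Matrix.of fun _ _ => (1 : ℝ)
  | r + 1 =>
      (kron (mkronPow A r) A).submatrix (Fin.cast (pow_succ a r)) (Fin.cast (pow_succ b r))

/-- `X_n^{(r)}(x) := H_n(x)ᵀ ⊗^r H_n(x) = (H_n(x)ᵀ)^{⊗r} ⊗ H_n(x)`,
a matrix in `ℝ^{(n+1) × (n+1)^r}`. -/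
def Xmat (n r : ℕ) (x : ℝ) : Matrix (Fin (n + 1)) (Fin ((n + 1) ^ r)) ℝ :=
  (kron (mkronPow (rowOf (Hmon n x)) r) (colOf (Hmon n x))).submatrix
    (Fin.cast (by simp)) (Fin.cast (by simp))

/-- The L-eliminating matrix
`E_{n,m} = ∑_{i=1}^n e_{n+m-1,i} ⊗ e_{m,1}ᵀ ⊗ e_{n,i}ᵀ + ∑_{i=2}^m e_{n+m-1,n+i-1} ⊗ e_{m,i}ᵀ ⊗ e_{n,n}ᵀ`,
written entrywise: the `i`-th summand of the first sum is the matrix with a single `1` in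
(1-based) position `(i, i)`, and the `i`-th summand of the second sum has its single `1` in
position `(n+i-1, n·i)`. -/
def Emat (n m : ℕ) : Matrix (Fin (n + m - 1)) (Fin (n * m)) ℝ :=
  Matrix.of fun r c =>
    (∑ i ∈ Finset.range n, if r.1 = i ∧ c.1 = i then (1 : ℝ) else 0) +
    (∑ i ∈ Finset.Icc 2 m, if r.1 = n + i - 2 ∧ c.1 + 1 = n * i then (1 : ℝ) else 0)

/-- The L-duplicating matrix `D_{n,m} = ∑_{i=1}^n ∑_{j=1}^m e_{n+m-1,i+j-1}ᵀ ⊗ e_{m,j} ⊗ e_{n,i}`,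
written entrywise: the `(i,j)` summand is the matrix with a single `1` in (1-based) position
`(n(j-1)+i, i+j-1)`. -/
def Dmat (n m : ℕ) : Matrix (Fin (n * m)) (Fin (n + m - 1)) ℝ :=
  Matrix.of fun r c =>
    ∑ i ∈ Finset.range n, ∑ j ∈ Finset.range m,
      if r.1 = n * j + i ∧ c.1 = i + j then (1 : ℝ) else 0

lemma arA (n : ℕ) : n * (0 + 2) + 1 = (n + 1) + (n + 1) - 1 := by omega

lemma arB (n : ℕ) : (n + 1) ^ (0 + 2) = (n + 1) * (n + 1) := by ring

lemma arC (n k : ℕ) : (n * (k + 2) + 1) * (n + 1) = (n + 1) * (n * (k + 2) + 1) :=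
  Nat.mul_comm _ _

lemma arD (n k : ℕ) : n * (k + 1 + 2) + 1 = n * (k + 2) + 1 + (n + 1) - 1 := by
  rw [Nat.add_sub_assoc (Nat.le_add_left 1 n), Nat.add_sub_cancel]
  ring

lemma arE (n k : ℕ) : (n + 1) ^ (k + 1 + 2) = (n + 1) * (n + 1) ^ (k + 2) := by ring

/-- The iterated L-eliminating matrices `E_{n+1}^{(m)}` (here indexed by `k := m - 1`):
`E_{n+1}^{(1)} = E_{n+1,n+1}` and `E_{n+1}^{(m)} = E_{nm+1,n+1} · (I_{n+1} ⊗ E_{n+1}^{(m-1)})`. -/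
def EL (n : ℕ) : (k : ℕ) → Matrix (Fin (n * (k + 2) + 1)) (Fin ((n + 1) ^ (k + 2))) ℝ
  | 0 => (Emat (n + 1) (n + 1)).submatrix (Fin.cast (arA n)) (Fin.cast (arB n))
  | k + 1 =>
      (Emat (n * (k + 2) + 1) (n + 1) *
        (kron (1 : Matrix (Fin (n + 1)) (Fin (n + 1)) ℝ) (EL n k)).submatrix
          (Fin.cast (arC n k)) id).submatrix
        (Fin.cast (arD n k)) (Fin.cast (arE n k))

/-- The iterated L-duplicating matrices `D_{n+1}^{(m)}` (here indexed by `k := m - 1`):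
`D_{n+1}^{(1)} = D_{n+1,n+1}` and `D_{n+1}^{(m)} = (I_{n+1} ⊗ D_{n+1}^{(m-1)}) · D_{nm+1,n+1}`. -/
def DL (n : ℕ) : (k : ℕ) → Matrix (Fin ((n + 1) ^ (k + 2))) (Fin (n * (k + 2) + 1)) ℝ
  | 0 => (Dmat (n + 1) (n + 1)).submatrix (Fin.cast (arB n)) (Fin.cast (arA n))
  | k + 1 =>
      ((kron (1 : Matrix (Fin (n + 1)) (Fin (n + 1)) ℝ) (DL n k)).submatrix
          id (Fin.cast (arC n k)) * Dmat (n * (k + 2) + 1) (n + 1)).submatrix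
        (Fin.cast (arE n k)) (Fin.cast (arD n k))

/-- The exponent `γ_{n,r}^{(k)} = ∑_{j=0}^{r-1} ((k-1) mod (n+1)^{r-j}) div (n+1)^{r-1-j}`
(`k` is 1-based). -/
def gamExp (n r k : ℕ) : ℕ :=
  ∑ j ∈ Finset.range r, ((k - 1) % (n + 1) ^ (r - j)) / (n + 1) ^ (r - 1 - j)

/-- Entry `(p, q)` (0-based) of the generator matrix of a polynomial jump-diffusion with
drift `b₀ + b₁ x`, squared diffusion `σ₀ + σ₁ x + σ₂ x²`, and jump moments
`∫ z^m ℓ(x,dz) = ∑_{i=0}^m ξ_i^m x^i` (`ξ m i` denotes `ξ_i^m`), with respect to the monomial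
basis. -/
noncomputable def genEntry (b₀ b₁ σ₀ σ₁ σ₂ : ℝ) (ξ : ℕ → ℕ → ℝ) (p q : ℕ) : ℝ :=
  if q = p then
    (p : ℝ) * b₁ + (1 / 2) * (p : ℝ) * ((p : ℝ) - 1) * σ₂ +
      ∑ k ∈ Finset.Icc 2 p, (p.choose k : ℝ) * ξ k k
  else if q + 1 = p then
    (p : ℝ) * b₀ + (1 / 2) * (p : ℝ) * ((p : ℝ) - 1) * σ₁ +
      ∑ k ∈ Finset.Icc 2 p, (p.choose k : ℝ) * ξ k (k - 1)
  else if q + 2 = p then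
    (1 / 2) * (p : ℝ) * ((p : ℝ) - 1) * σ₀ +
      ∑ k ∈ Finset.Icc 2 p, (p.choose k : ℝ) * ξ k (k - 2)
  else if q + 2 < p then
    ∑ k ∈ Finset.Icc (p - q) p, (p.choose k : ℝ) * ξ k (k - (p - q))
  else 0

/-- The generator matrix `G_n` of a polynomial jump-diffusion w.r.t. the monomial basis. -/
noncomputable def genMat (b₀ b₁ σ₀ σ₁ σ₂ : ℝ) (ξ : ℕ → ℕ → ℝ) (n : ℕ) :
    Matrix (Fin (n + 1)) (Fin (n + 1)) ℝ :=
  Matrix.of fun p q => genEntry b₀ b₁ σ₀ σ₁ σ₂ ξ p.1 q.1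


lemma block_idx {n r k : ℕ} (hr : 1 ≤ r) (hk1 : 1 ≤ k) (hk2 : k ≤ (n + 1) ^ (r - 1))
    (c : Fin (n + 1)) : (k - 1) * (n + 1) + c.1 < (n + 1) ^ r := by
  have hc := c.2
  have h1 : (k - 1 + 1) * (n + 1) ≤ (n + 1) ^ (r - 1) * (n + 1) :=
    Nat.mul_le_mul_right (n + 1) (by omega)
  have h2 : (n + 1) ^ (r - 1) * (n + 1) = (n + 1) ^ r := by
    rw [← pow_succ]
    congr 1
    omega
  have h3 : (k - 1) * (n + 1) + c.1 < (k - 1 + 1) * (n + 1) := by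
    rw [Nat.add_mul]
    omega
  omega
/-- Let `n ≥ 2`, `b₁, σ₂ ∈ ℝ`, and `c_j := j·b₁ + ½j(j−1)σ₂` (so `c₁ = b₁`).
Then `(c_j ≠ 0 for 2 ≤ j ≤ n) ∧ (c_j ≠ c_i for 1 ≤ j < i ≤ n)` holds iff
`b₁ ≠ −(k/2)σ₂` for every `1 ≤ k ≤ 2(n−1)`; in particular, under this condition `b₁` and `σ₂`
cannot both be zero. -/
theorem stmt16 (n : ℕ) (hn : 2 ≤ n) (b₁ σ₂ : ℝ) :
    (((∀ j : ℕ, 2 ≤ j → j ≤ n →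
          (j : ℝ) * b₁ + (1 / 2) * (j : ℝ) * ((j : ℝ) - 1) * σ₂ ≠ 0) ∧
        (∀ j i : ℕ, 1 ≤ j → j < i → i ≤ n →
          (j : ℝ) * b₁ + (1 / 2) * (j : ℝ) * ((j : ℝ) - 1) * σ₂
            ≠ (i : ℝ) * b₁ + (1 / 2) * (i : ℝ) * ((i : ℝ) - 1) * σ₂))
      ↔ (∀ k : ℕ, 1 ≤ k → k ≤ 2 * (n - 1) → b₁ ≠ -((k : ℝ) / 2) * σ₂)) ∧
    ((∀ k : ℕ, 1 ≤ k → k ≤ 2 * (n - 1) → b₁ ≠ -((k : ℝ) / 2) * σ₂) →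
      ¬(b₁ = 0 ∧ σ₂ = 0)) := by
  have hdiff (j i : ℕ) :
      ((j : ℝ) * b₁ + (1 / 2) * (j : ℝ) * ((j : ℝ) - 1) * σ₂) -
        ((i : ℝ) * b₁ + (1 / 2) * (i : ℝ) * ((i : ℝ) - 1) * σ₂) =
      ((j : ℝ) - i) * (b₁ + ((i : ℝ) + j - 1) / 2 * σ₂) := by ring
  refine ⟨⟨?_, ?_⟩, ?_⟩
  · rintro ⟨hzero, hne⟩ k hk1 hkn hb
    obtain rfl | hk2 := hk1.eq_or_lt
    · refine hzero 2 le_rfl hn ?_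
      rw [hb]
      push_cast
      ring
    · refine hne (k / 2) (k + 1 - k / 2) (by omega) (by omega) (by omega) ?_
      rw [← sub_eq_zero, hdiff, hb, Nat.cast_sub (by omega : k / 2 ≤ k + 1)]
      push_cast
      ring
  · intro h
    refine ⟨fun j hj2 hjn h0 => ?_, fun j i hj hji hin heq => ?_⟩
    · have hj : (j : ℝ) ≠ 0 := by
        exact_mod_cast (by omega : j ≠ 0)
      refine h (j - 1) (by omega) (by omega) (mul_left_cancel₀ hj ?_)
      rw [Nat.cast_sub (by omega : 1 ≤ j)]
      push_cast
      linear_combination h0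
    · have hsub : (j : ℝ) - i ≠ 0 := sub_ne_zero.mpr (by exact_mod_cast hji.ne)
      refine h (i + j - 1) (by omega) (by omega) ?_
      rw [← sub_eq_zero, hdiff] at heq
      rw [Nat.cast_sub (by omega : 1 ≤ i + j)]
      push_cast
      linear_combination (mul_eq_zero.mp heq).resolve_left hsub
  · rintro h ⟨rfl, rfl⟩
    exact h 1 le_rfl (by omega) (by simp)

end Correlators
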